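/- Let z ∈ t_Q satisfy γ(z) ∈ {-1, 0, 1, 2} for all γ ∈ Δ⁺, suppose that the root subsystem Δ_z(0) = {γ ∈ Δ : γ(z) = 0} has rank equal to rk Δ − 1 and that θ(z) = 1, and let w_z ∈ W be the unique element with inversion set N(w_z) = Δ⁺_z(1) ∪ Δ⁺_z(2). Then w_z^{-1}(Π) = B ∪ {−θ}, where B is the base (set of simple roots) of Δ_z(0) contained in Δ⁺_z(0), i.e., the set of roots of Δ⁺_z(0) that are not sums of two roots from Δ⁺_z(0). -/

import Mathlib

open scoped RealInnerProductSpace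

attribute [local instance] Classical.propDecidable

section RootCombinatorics

variable {V : Type*} [NormedAddCommGroup V] [InnerProductSpace ℝ V]

/-- The Cartan pairing `⟨γ, α∨⟩ = 2 (γ, α) / (α, α)`. -/
noncomputable def cartanPairing (γ α : V) : ℝ := 2 * ⟪γ, α⟫ / ⟪α, α⟫

/-- The coroot `γ∨ = 2 γ / (γ, γ)`. -/
noncomputable def covec (γ : V) : V := (2 / ⟪γ, γ⟫) • γ

/-- The cascade element `x_K = Σ_{β ∈ K} β / (β, β) = ½ Σ_{β ∈ K} β∨`. -/
noncomputable def cascElt (K : Finset V) : V := ∑ β ∈ K, (⟪β, β⟫)⁻¹ • β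

/-- The roots of `S` orthogonal to `β`. -/
noncomputable def orthSub (S : Finset V) (β : V) : Finset V := S.filter fun γ => ⟪γ, β⟫ = 0

/-- One step of the non-orthogonality (connectedness) relation inside `S`. -/
def connRel (S : Finset V) (a b : V) : Prop := a ∈ S ∧ b ∈ S ∧ ⟪a, b⟫ ≠ 0

/-- The irreducible component of the root subsystem `S` containing `γ`. -/
noncomputable def component (S : Finset V) (γ : V) : Finset V :=
  S.filter fun γ' => Relation.ReflTransGen (connRel S) γ γ'

/-- `C` is an irreducible component of the root subsystem `S`. -/
def IsComponent (S C : Finset V) : Prop := ∃ γ ∈ S, C = component S γ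

end RootCombinatorics

/-- The combinatorial data of an irreducible crystallographic root system with a chosen
system of positive roots, base (set of simple roots) and highest root: the combinatorial
skeleton of a finite-dimensional complex simple Lie algebra, with the Killing-form
identification of the Cartan subalgebra and its dual. -/
structure RootSystemCtx (V : Type*) [NormedAddCommGroup V] [InnerProductSpace ℝ V] where
  /-- the set of roots Δ -/
  Δ : Finset V
  /-- the set of simple roots Π -/
  base : Finset V
  /-- the set of positive roots Δ⁺ -/
  Pos : Finset V
  /-- the highest root θ -/
  θ : V
  zero_not_mem : (0 : V) ∉ Δ
  neg_mem : ∀ γ ∈ Δ, -γ ∈ Δ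
  reflect_mem : ∀ α ∈ Δ, ∀ γ ∈ Δ, γ - cartanPairing γ α • α ∈ Δ
  pairing_int : ∀ α ∈ Δ, ∀ γ ∈ Δ, ∃ k : ℤ, cartanPairing γ α = (k : ℝ)
  span_eq : Submodule.span ℝ (Δ : Set V) = ⊤
  base_subset : base ⊆ Pos
  base_indep : LinearIndependent ℝ (fun a : {x // x ∈ base} => (a : V))
  pos_subset : Pos ⊆ Δ
  pos_or_neg : ∀ γ ∈ Δ, γ ∈ Pos ∨ -γ ∈ Pos
  pos_not_neg : ∀ γ ∈ Pos, -γ ∉ Pos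
  pos_coords : ∀ γ ∈ Pos, γ ∈ AddSubmonoid.closure (base : Set V)
  irreducible : ∀ S : Finset V, S ⊆ Δ → S.Nonempty →
    (∀ a ∈ S, ∀ b ∈ Δ, b ∉ S → ⟪a, b⟫ = 0) → S = Δ
  theta_mem : θ ∈ Pos
  theta_highest : ∀ γ ∈ Δ, θ - γ ∈ AddSubmonoid.closure (base : Set V)

namespace RootSystemCtx

variable {V : Type*} [NormedAddCommGroup V] [InnerProductSpace ℝ V]

variable (ctx : RootSystemCtx V)

/-- The root order `γ ≼ γ'` on roots: `γ' - γ` is a nonnegative integral combination of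
simple roots. -/
def rootLE (γ γ' : V) : Prop := γ' - γ ∈ AddSubmonoid.closure (ctx.base : Set V)

/-- `β` is the highest root of the root subsystem `S` (with respect to the ambient positive
system). -/
def IsHighest (S : Finset V) (β : V) : Prop :=
  β ∈ S ∧ β ∈ ctx.Pos ∧ ∀ γ ∈ S, ctx.rootLE γ β

/-- `CascadeMem ctx S β` : the pair (root subsystem `S = Δ⟨i⟩`, its highest root `β = βᵢ`)
occurs in the recursive construction of the Kostant cascade: one starts with `(Δ, θ)`, and the
descendants of `(S, β)` are the pairs `(C, β')` where `C` is an irreducible component of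
`{γ ∈ S | (γ, β) = 0}` and `β'` is the highest root of `C`. -/
inductive CascadeMem : Finset V → V → Prop
  | top : CascadeMem ctx.Δ ctx.θ
  | step {S C : Finset V} {β β' : V} : CascadeMem S β →
      IsComponent (orthSub S β) C → ctx.IsHighest C β' → CascadeMem C β'

/-- `K` is the Kostant cascade of the root system. -/
def IsCascade (K : Finset V) : Prop := ∀ β, β ∈ K ↔ ∃ S, ctx.CascadeMem S β

/-- The Heisenberg subset `H_β = {γ ∈ S ∩ Δ⁺ : (γ, β) > 0}` attached to a cascade pair
`(S, β)`. -/
noncomputable def heis (S : Finset V) (β : V) : Finset V :=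
  S.filter fun γ => γ ∈ ctx.Pos ∧ 0 < ⟪γ, β⟫

/-- A root is long if it has the same length as the highest root. -/
def IsLong (γ : V) : Prop := ⟪γ, γ⟫ = ⟪ctx.θ, ctx.θ⟫

/-- The highest root `θ` is a fundamental weight. -/
def ThetaFundamental : Prop :=
  ∃ α ∈ ctx.base, cartanPairing ctx.θ α = 1 ∧
    ∀ β ∈ ctx.base, β ≠ α → cartanPairing ctx.θ β = 0

/-- `β'` is a descendant of the cascade element `β`. -/
def Desc (β β' : V) : Prop :=
  ∃ S C, ctx.CascadeMem S β ∧ IsComponent (orthSub S β) C ∧ ctx.IsHighest C β'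

/-- The cascade poset order: `β ≤ β'` iff `β` is an iterated descendant of `β'`. -/
def cascLE (β β' : V) : Prop := Relation.ReflTransGen (fun a b => ctx.Desc b a) β β'

/-- A simple reflection of the root system. -/
def IsSimpleReflection (w : V ≃ₗ[ℝ] V) : Prop :=
  ∃ α ∈ ctx.base, ∀ v, w v = v - (2 * ⟪v, α⟫ / ⟪α, α⟫) • α

/-- The Weyl group, generated by the simple reflections. -/
def weylGroup : Subgroup (V ≃ₗ[ℝ] V) := Subgroup.closure {w | ctx.IsSimpleReflection w}

/-- The length of a Weyl group element: the minimal number of simple reflections needed to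
express it. -/
noncomputable def length (w : V ≃ₗ[ℝ] V) : ℕ :=
  sInf {n | ∃ l : List (V ≃ₗ[ℝ] V), l.length = n ∧
    (∀ s ∈ l, ctx.IsSimpleReflection s) ∧ l.prod = w}

/-- The root system is of type `Aₙ` (Cartan matrix characterisation). -/
def IsTypeA (n : ℕ) : Prop :=
  1 ≤ n ∧ ∃ e : Fin n ≃ {x // x ∈ ctx.base}, ∀ i j : Fin n,
    cartanPairing (e i : V) (e j : V) =
      (if i = j then 2 else if i.val + 1 = j.val ∨ j.val + 1 = i.val then -1 else 0)

/-- The root system is of type `Bₙ` (`n ≥ 2`), with the last simple root short. -/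
def IsTypeB (n : ℕ) : Prop :=
  2 ≤ n ∧ ∃ e : Fin n ≃ {x // x ∈ ctx.base}, ∀ i j : Fin n,
    cartanPairing (e i : V) (e j : V) =
      (if i = j then 2
       else if i.val + 2 = n ∧ j.val + 1 = n then -2
       else if i.val + 1 = j.val ∨ j.val + 1 = i.val then -1 else 0)

/-- The root system is of type `Cₙ` (`n ≥ 2`), with the last simple root long. -/
def IsTypeC (n : ℕ) : Prop :=
  2 ≤ n ∧ ∃ e : Fin n ≃ {x // x ∈ ctx.base}, ∀ i j : Fin n,
    cartanPairing (e i : V) (e j : V) =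
      (if i = j then 2
       else if i.val + 1 = n ∧ j.val + 2 = n then -2
       else if i.val + 1 = j.val ∨ j.val + 1 = i.val then -1 else 0)

/-- The root system is of type `G₂` (first simple root short). -/
def IsTypeG2 : Prop :=
  ∃ e : Fin 2 ≃ {x // x ∈ ctx.base},
    cartanPairing (e 0 : V) (e 0 : V) = 2 ∧ cartanPairing (e 1 : V) (e 1 : V) = 2 ∧
    cartanPairing (e 0 : V) (e 1 : V) = -1 ∧ cartanPairing (e 1 : V) (e 0 : V) = -3

/-- The set of roots `Δ(a_z) = w(Δ⁺_z(-1)) ∪ w(-Δ⁺_z(2))` of the abelian ideal attached by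
Kostant's construction to `z` (with `w = w_z`). -/
def idealSet (w : V ≃ₗ[ℝ] V) (x : V) : Set V :=
  {δ | ∃ γ ∈ ctx.Pos, (⟪γ, x⟫ = -1 ∧ δ = w γ) ∨ (⟪γ, x⟫ = 2 ∧ δ = -(w γ))}

end RootSystemCtx

namespace RootSystemCtx

variable {V : Type*} [NormedAddCommGroup V] [InnerProductSpace ℝ V]

variable (ctx : RootSystemCtx V)

lemma ne_zero_of_mem {γ : V} (hγ : γ ∈ ctx.Δ) : γ ≠ 0 := by
  rintro rfl
  exact ctx.zero_not_mem hγ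

lemma span_base : Submodule.span ℝ (ctx.base : Set V) = ⊤ := by
  have hpos : ∀ γ ∈ ctx.Pos, γ ∈ Submodule.span ℝ (ctx.base : Set V) := fun γ hγ =>
    (AddSubmonoid.closure_le (S := (Submodule.span ℝ (ctx.base : Set V)).toAddSubmonoid)).2
      Submodule.subset_span (ctx.pos_coords γ hγ)
  rw [eq_top_iff, ← ctx.span_eq, Submodule.span_le]
  intro γ hγ
  rcases ctx.pos_or_neg γ hγ with h | h
  · exact hpos γ h
  · exact (Submodule.neg_mem_iff _).1 (hpos _ h)

/-- The height functional, equal to `1` on every simple root. -/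
lemma exists_height : ∃ ht : V →ₗ[ℝ] ℝ, ∀ α ∈ ctx.base, ht α = 1 := by
  let b := Module.Basis.mk ctx.base_indep (by simp [ctx.span_base])
  refine ⟨b.constr ℝ fun _ => (1 : ℝ), fun α hα => ?_⟩
  have h := b.constr_basis ℝ (fun _ => (1 : ℝ)) ⟨α, hα⟩
  rwa [Module.Basis.mk_apply] at h

lemma eq_zero_or_one_le_height {ht : V →ₗ[ℝ] ℝ} (hht : ∀ α ∈ ctx.base, ht α = 1) {v : V}
    (hv : v ∈ AddSubmonoid.closure (ctx.base : Set V)) : v = 0 ∨ 1 ≤ ht v := by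
  induction hv using AddSubmonoid.closure_induction with
  | mem x hx => exact Or.inr (hht x hx).ge
  | zero => exact Or.inl rfl
  | add x y _ _ hx hy =>
    rcases hx with rfl | hx
    · simpa using hy
    · rcases hy with rfl | hy
      · simpa using Or.inr hx
      · right
        rw [map_add]
        linarith

lemma eq_zero_of_mem_of_neg_mem {v : V} (hv : v ∈ AddSubmonoid.closure (ctx.base : Set V))
    (hv' : -v ∈ AddSubmonoid.closure (ctx.base : Set V)) : v = 0 := by
  obtain ⟨ht, hht⟩ := ctx.exists_height
  rcases ctx.eq_zero_or_one_le_height hht hv with h | h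
  · exact h
  · rcases ctx.eq_zero_or_one_le_height hht hv' with h' | h'
    · exact neg_eq_zero.1 h'
    · rw [map_neg] at h'
      linarith

lemma add_notMem_base {γ₁ γ₂ : V} (h₁ : γ₁ ∈ ctx.Pos) (h₂ : γ₂ ∈ ctx.Pos) :
    γ₁ + γ₂ ∉ ctx.base := by
  intro hα
  obtain ⟨ht, hht⟩ := ctx.exists_height
  have one_le : ∀ γ ∈ ctx.Pos, 1 ≤ ht γ := fun γ hγ =>
    (ctx.eq_zero_or_one_le_height hht (ctx.pos_coords γ hγ)).resolve_left
      (ctx.ne_zero_of_mem (ctx.pos_subset hγ))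
  have h := hht _ hα
  rw [map_add] at h
  linarith [one_le _ h₁, one_le _ h₂]

lemma sub_mem_of_inner_pos {γ α : V} (hγ : γ ∈ ctx.Δ) (hα : α ∈ ctx.Δ)
    (hpos : 0 < ⟪γ, α⟫) (hne : γ ≠ α) : γ - α ∈ ctx.Δ := by
  obtain ⟨k, hk⟩ := ctx.pairing_int α hα γ hγ
  obtain ⟨l, hl⟩ := ctx.pairing_int γ hγ α hα
  have haa : 0 < ⟪α, α⟫ := real_inner_self_pos.2 (ctx.ne_zero_of_mem hα)
  have hgg : 0 < ⟪γ, γ⟫ := real_inner_self_pos.2 (ctx.ne_zero_of_mem hγ)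
  by_cases hk1 : k = 1
  · simpa [hk, hk1] using ctx.reflect_mem α hα γ hγ
  by_cases hl1 : l = 1
  · simpa [hl, hl1] using ctx.neg_mem _ (ctx.reflect_mem γ hγ α hα)
  exfalso
  rw [cartanPairing, div_eq_iff haa.ne'] at hk
  rw [cartanPairing, div_eq_iff hgg.ne', real_inner_comm] at hl
  have hk2 : (2 : ℝ) ≤ k := by
    have : (0 : ℝ) < k := by
      by_contra! h
      nlinarith
    have : 0 < k := by exact_mod_cast this
    exact_mod_cast (by omega : (2 : ℤ) ≤ k)
  have hl2 : (2 : ℝ) ≤ l := by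
    have : (0 : ℝ) < l := by
      by_contra! h
      nlinarith
    have : 0 < l := by exact_mod_cast this
    exact_mod_cast (by omega : (2 : ℤ) ≤ l)
  have hsub : ⟪γ - α, γ - α⟫ ≤ 0 := by
    rw [real_inner_sub_sub_self]
    nlinarith
  exact hne (sub_eq_zero.1 (real_inner_self_nonpos.1 hsub))

lemma exists_base_inner_pos {γ : V} (hγ : γ ∈ ctx.Pos) : ∃ α ∈ ctx.base, 0 < ⟪γ, α⟫ := by
  by_contra! h
  have nonpos : ∀ v ∈ AddSubmonoid.closure (ctx.base : Set V), ⟪γ, v⟫ ≤ 0 := by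
    intro v hv
    induction hv using AddSubmonoid.closure_induction with
    | mem x hx => exact h x hx
    | zero => simp
    | add x y _ _ hx hy =>
      rw [inner_add_right]
      linarith
  exact ctx.ne_zero_of_mem (ctx.pos_subset hγ)
    (real_inner_self_nonpos.1 (nonpos γ (ctx.pos_coords γ hγ)))

/-- A positive root that is not simple is the sum of a simple root and a positive root. -/
lemma exists_base_sub_mem_pos {γ : V} (hγ : γ ∈ ctx.Pos) (hγb : γ ∉ ctx.base) :
    ∃ α ∈ ctx.base, γ - α ∈ ctx.Pos := by
  obtain ⟨α, hα, hpos⟩ := ctx.exists_base_inner_pos hγ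
  refine ⟨α, hα, ?_⟩
  have hne : γ ≠ α := fun h => hγb (h ▸ hα)
  have hmem := ctx.sub_mem_of_inner_pos (ctx.pos_subset hγ)
    (ctx.pos_subset (ctx.base_subset hα)) hpos hne
  refine (ctx.pos_or_neg _ hmem).resolve_right fun hneg => ctx.add_notMem_base hγ hneg ?_
  simpa using hα

lemma weylGroup_apply_mem_iff {w : V ≃ₗ[ℝ] V} (hw : w ∈ ctx.weylGroup) (γ : V) :
    w γ ∈ ctx.Δ ↔ γ ∈ ctx.Δ := by
  induction hw using Subgroup.closure_induction generalizing γ with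
  | mem s hs =>
    obtain ⟨α, hα, hs⟩ := hs
    have hαΔ := ctx.pos_subset (ctx.base_subset hα)
    have maps : ∀ γ ∈ ctx.Δ, s γ ∈ ctx.Δ := fun γ hγ => by
      rw [hs]
      exact ctx.reflect_mem α hαΔ γ hγ
    have invol : s (s γ) = γ := by
      have haa : ⟪α, α⟫ ≠ 0 := inner_self_ne_zero.2 (ctx.ne_zero_of_mem hαΔ)
      rw [hs (s γ), hs γ, sub_sub, ← add_smul, inner_sub_left, real_inner_smul_left]
      field_simp
      norm_num
    exact ⟨fun h => invol ▸ maps _ h, maps γ⟩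
  | one => simp
  | mul s t _ _ hs ht => exact (hs (t γ)).trans (ht γ)
  | inv s _ hs => simpa using (hs (s⁻¹ γ)).symm

/-- If a functional takes only the value `0`, the value `-1` and values at most `-2` on simple
roots, then an element of the positive cone with value `0` is a combination of simple roots of
value `0`, and one with value `-1` involves exactly one further simple root. -/
lemma cone_value_cases (f : V →ₗ[ℝ] ℝ)
    (hf : ∀ α ∈ ctx.base, f α = 0 ∨ f α = -1 ∨ f α ≤ -2) {v : V}
    (hv : v ∈ AddSubmonoid.closure (ctx.base : Set V)) :
    (f v = 0 ∧ v ∈ AddSubmonoid.closure {α | α ∈ ctx.base ∧ f α = 0}) ∨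
    (f v = -1 ∧ ∃ β ∈ ctx.base, f β = -1 ∧
      v - β ∈ AddSubmonoid.closure {α | α ∈ ctx.base ∧ f α = 0}) ∨
    f v ≤ -2 := by
  induction hv using AddSubmonoid.closure_induction with
  | mem x hx =>
    rcases hf x hx with h | h | h
    · exact Or.inl ⟨h, AddSubmonoid.subset_closure ⟨hx, h⟩⟩
    · exact Or.inr (Or.inl ⟨h, x, hx, h, by simp⟩)
    · exact Or.inr (Or.inr h)
  | zero => exact Or.inl ⟨map_zero f, zero_mem _⟩
  | add x y _ _ hx hy =>
    rw [map_add]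
    rcases hx with ⟨hx, hxm⟩ | ⟨hx, β, hβ, hβf, hxm⟩ | hx <;>
    rcases hy with ⟨hy, hym⟩ | ⟨hy, β', hβ', hβf', hym⟩ | hy
    · exact Or.inl ⟨by linarith, add_mem hxm hym⟩
    · refine Or.inr (Or.inl ⟨by linarith, β', hβ', hβf', ?_⟩)
      rw [add_sub_assoc]
      exact add_mem hxm hym
    · exact Or.inr (Or.inr (by linarith))
    · refine Or.inr (Or.inl ⟨by linarith, β, hβ, hβf, ?_⟩)
      rw [add_sub_right_comm]
      exact add_mem hxm hym
    all_goals exact Or.inr (Or.inr (by linarith))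

end RootSystemCtx

/-- If `Δ_z(0)` has corank one and `θ(z) = 1`, then `w_z⁻¹(Π)` consists of `-θ` together with
the base of `Δ_z(0)` contained in `Δ⁺_z(0)`. -/
theorem w_z_inv_base {V : Type*} [NormedAddCommGroup V] [InnerProductSpace ℝ V]
    [FiniteDimensional ℝ V] (ctx : RootSystemCtx V)
    (z : V)
    (hz : ∀ γ ∈ ctx.Pos, ⟪γ, z⟫ = -1 ∨ ⟪γ, z⟫ = 0 ∨ ⟪γ, z⟫ = 1 ∨ ⟪γ, z⟫ = 2)
    (hrank : Module.finrank ℝ ↥(Submodule.span ℝ {γ : V | γ ∈ ctx.Δ ∧ ⟪γ, z⟫ = 0}) =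
      ctx.base.card - 1)
    (hθ : ⟪ctx.θ, z⟫ = 1)
    (w : V ≃ₗ[ℝ] V) (hw : w ∈ ctx.weylGroup)
    (hN : ∀ γ ∈ ctx.Pos, (-(w γ) ∈ ctx.Pos ↔ (⟪γ, z⟫ = 1 ∨ ⟪γ, z⟫ = 2))) :
    {v : V | ∃ α ∈ ctx.base, v = w.symm α} =
      {γ : V | γ ∈ ctx.Pos ∧ ⟪γ, z⟫ = 0 ∧
        ¬ ∃ γ₁ ∈ ctx.Pos, ∃ γ₂ ∈ ctx.Pos,
          ⟪γ₁, z⟫ = 0 ∧ ⟪γ₂, z⟫ = 0 ∧ γ = γ₁ + γ₂} ∪ {-ctx.θ} := by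
  let f : V →ₗ[ℝ] ℝ := (innerₗ V z).comp w.symm.toLinearMap
  have hf : ∀ v, f v = ⟪w.symm v, z⟫ := fun v => real_inner_comm _ _
  have hfw : ∀ v, f (w v) = ⟪v, z⟫ := fun v => by rw [hf, w.symm_apply_apply]
  have hΔ := ctx.weylGroup_apply_mem_iff hw
  have value_pos : ∀ δ ∈ ctx.Pos, (f δ = 0 ∧ w.symm δ ∈ ctx.Pos) ∨ f δ = -1 ∨ f δ = -2 := by
    intro δ hδ
    obtain ⟨γ, rfl⟩ := w.surjective δ
    rw [hfw, w.symm_apply_apply]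
    rcases ctx.pos_or_neg γ ((hΔ γ).1 (ctx.pos_subset hδ)) with hγ | hγ
    · have h := mt (hN γ hγ).2 (ctx.pos_not_neg _ hδ)
      have := hz γ hγ
      tauto
    · have h := (hN _ hγ).1 (by simpa using hδ)
      rw [inner_neg_left] at h
      right
      rcases h with h | h
      · left; linarith
      · right; linarith
  have map_pos : ∀ γ ∈ ctx.Pos, ⟪γ, z⟫ = 0 → w γ ∈ ctx.Pos := by
    intro γ hγ h0
    refine (ctx.pos_or_neg _ ((hΔ γ).2 (ctx.pos_subset hγ))).resolve_right fun h => ?_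
    rcases (hN γ hγ).1 h with h | h <;> rw [h0] at h <;> norm_num at h
  have value_base : ∀ α ∈ ctx.base, f α = 0 ∨ f α = -1 ∨ f α ≤ -2 := by
    intro α hα
    rcases value_pos α (ctx.base_subset hα) with h | h | h
    · exact Or.inl h.1
    · exact Or.inr (Or.inl h)
    · exact Or.inr (Or.inr h.le)
  have eq_of_value_ne : ∀ α ∈ ctx.base, ∀ β ∈ ctx.base, f α ≠ 0 → f β ≠ 0 → α = β := by
    intro α hα β hβ hfα hfβ
    by_contra hne
    let S := ctx.base.filter fun δ => f δ = 0
    have cone_mem : ∀ δ ∈ ctx.Pos, f δ = 0 → δ ∈ Submodule.span ℝ (S : Set V) := by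
      intro δ hδ h0
      rcases ctx.cone_value_cases f value_base (ctx.pos_coords δ hδ) with h | h | h
      · refine (AddSubmonoid.closure_le
          (S := (Submodule.span ℝ (S : Set V)).toAddSubmonoid)).2 ?_ h.2
        intro x hx
        exact Submodule.subset_span (by simpa [S] using hx)
      · linarith [h.1]
      · linarith
    have hle : Submodule.span ℝ {γ : V | γ ∈ ctx.Δ ∧ ⟪γ, z⟫ = 0} ≤
        (Submodule.span ℝ (S : Set V)).comap w.toLinearMap := by
      rw [Submodule.span_le]
      rintro γ ⟨hγ, h0⟩
      rcases ctx.pos_or_neg γ hγ with h | h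
      · exact cone_mem (w γ) (map_pos γ h h0) ((hfw γ).trans h0)
      · have h0' : ⟪-γ, z⟫ = 0 := by rw [inner_neg_left, h0, neg_zero]
        have := cone_mem _ (map_pos _ h h0') (by rw [hfw, h0'])
        rw [map_neg, Submodule.neg_mem_iff] at this
        exact this
    have hrankS : ctx.base.card - 1 ≤ S.card := by
      rw [← hrank]
      refine (Submodule.finrank_mono hle).trans ?_
      rw [Submodule.comap_equiv_eq_map_symm, LinearEquiv.finrank_map_eq]
      exact finrank_span_finset_le_card S
    have hsub : S ⊆ (ctx.base.erase α).erase β := by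
      intro δ hδ
      obtain ⟨hδ, h0⟩ := Finset.mem_filter.1 hδ
      simp only [Finset.mem_erase]
      exact ⟨fun h => hfβ (h ▸ h0), fun h => hfα (h ▸ h0), hδ⟩
    have hcard := Finset.card_le_card hsub
    have hβ' : β ∈ ctx.base.erase α := Finset.mem_erase.2 ⟨Ne.symm hne, hβ⟩
    have := Finset.card_erase_add_one hβ'
    have := Finset.card_erase_add_one hα
    omega
  have theta_base : ∃ β ∈ ctx.base, f β = -1 ∧ w.symm β = -ctx.θ := by
    have hθ' : -(w ctx.θ) ∈ ctx.Pos := (hN _ ctx.theta_mem).2 (Or.inl hθ)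
    have hfθ : f (-(w ctx.θ)) = -1 := by rw [map_neg, hfw, hθ]
    rcases ctx.cone_value_cases f value_base (ctx.pos_coords _ hθ') with h | h | h
    · linarith [h.1]
    · obtain ⟨-, β, hβ, hfβ, hmem⟩ := h
      refine ⟨β, hβ, hfβ, ?_⟩
      have cone : ∀ v ∈ AddSubmonoid.closure {α | α ∈ ctx.base ∧ f α = 0},
          w.symm v ∈ AddSubmonoid.closure (ctx.base : Set V) := by
        refine fun v hv => (AddSubmonoid.closure_le (S := (AddSubmonoid.closure
          (ctx.base : Set V)).comap w.symm.toLinearMap.toAddMonoidHom)).2 ?_ hv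
        rintro α ⟨hα, h0⟩
        rcases value_pos α (ctx.base_subset hα) with h | h | h
        · exact ctx.pos_coords _ h.2
        all_goals linarith
      have h1 := cone _ hmem
      rw [map_sub, map_neg, w.symm_apply_apply] at h1
      have hβΔ : w.symm β ∈ ctx.Δ := by
        rw [← hΔ, w.apply_symm_apply]
        exact ctx.pos_subset (ctx.base_subset hβ)
      have h2 := ctx.theta_highest _ (ctx.neg_mem _ hβΔ)
      have h3 := ctx.eq_zero_of_mem_of_neg_mem h1 (by convert h2 using 1; abel)
      exact (sub_eq_zero.1 h3).symm
    · linarith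
  obtain ⟨β, hβ, hfβ, hβθ⟩ := theta_base
  ext v
  constructor
  · rintro ⟨α, hα, rfl⟩
    by_cases h0 : f α = 0
    · left
      rcases value_pos α (ctx.base_subset hα) with h | h | h
      · refine ⟨h.2, by rw [← hf, h0], ?_⟩
        rintro ⟨γ₁, h₁, γ₂, h₂, hz₁, hz₂, hsum⟩
        refine ctx.add_notMem_base (map_pos _ h₁ hz₁) (map_pos _ h₂ hz₂) ?_
        rwa [← map_add, ← hsum, w.apply_symm_apply]
      all_goals linarith
    · right
      rw [eq_of_value_ne α hα β hβ h0 (by rw [hfβ]; norm_num), hβθ]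
      rfl
  · rintro (⟨hv, h0, hind⟩ | rfl)
    · refine ⟨w v, ?_, (w.symm_apply_apply v).symm⟩
      by_contra hvb
      obtain ⟨α, hα, hsub⟩ := ctx.exists_base_sub_mem_pos (map_pos v hv h0) hvb
      have hsum : f α + f (w v - α) = 0 := by
        rw [← map_add, add_sub_cancel, hfw, h0]
      have hα' := value_pos α (ctx.base_subset hα)
      have hsub' := value_pos _ hsub
      have hα0 : f α = 0 ∧ w.symm α ∈ ctx.Pos := by
        rcases hα' with h | h | h
        · exact h
        all_goals rcases hsub' with ⟨h', -⟩ | h' | h' <;> linarith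
      have hsub0 : f (w v - α) = 0 ∧ w.symm (w v - α) ∈ ctx.Pos := by
        rcases hsub' with h | h | h
        · exact h
        all_goals linarith [hα0.1]
      exact hind ⟨_, hα0.2, _, hsub0.2, by rw [← hf, hα0.1], by rw [← hf, hsub0.1], by simp⟩
    · exact ⟨β, hβ, hβθ.symm⟩
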